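/- Let q ≥ 1, m ≥ 2, ξ = exp(2πj/q), and y ∈ ℂ^{2^m}. For each integer i with 0 ≤ i < q define z(i) ∈ ℂ^{2^{m-1}} by z_k(i) = y_k + y_{k+2^{m-1}}·ξ^{-i}. Suppose that for each i, ẑ(i) is a polyphase codeword of RM_q(1,m−1) maximizing Re⟨z(i),w⟩ over all polyphase codewords w of RM_q(1,m−1), set p(i) = Re⟨z(i),ẑ(i)⟩, and let î ∈ {0,…,q−1} maximize p(i). Then x̂ = (ẑ(î) | ξ^{î}·ẑ(î)) is a polyphase codeword of RM_q(1,m) that minimizes ||y − x||² over all polyphase codewords x of RM_q(1,m) (i.e., x̂ is a maximum-likelihood codeword for y), and moreover Re⟨y,x̂⟩ = p(î). -/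

import Mathlib

open Matrix Complex Finset

noncomputable section

/-- `2 ^ (m + 1) = 2 ^ m + 2 ^ m`. -/
theorem two_pow_succ' (m : ℕ) : 2 ^ (m + 1) = 2 ^ m + 2 ^ m := by
  rw [pow_succ, mul_two]

/-- The generator matrix `G m` of the generalized first-order Reed–Muller code,
defined recursively: `G 1` is the 2×2 identity matrix, and
`G m = [[G (m-1), G (m-1)], [0, 1]]` for `m ≥ 2`.  (The value at `m = 0` is a
dummy that is never used, since all statements assume `m ≥ 1`.) -/
def G : (m : ℕ) → Matrix (Fin (m + 1)) (Fin (2 ^ m)) ℤ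
  | 0 => Matrix.of fun _ _ => 1
  | 1 => 1
  | (m + 2) => Matrix.of fun i k =>
      if hi : (i : ℕ) < m + 2 then
        G (m + 1) ⟨i, hi⟩ ⟨(k : ℕ) % 2 ^ (m + 1), Nat.mod_lt _ (by positivity)⟩
      else if (k : ℕ) < 2 ^ (m + 1) then 0 else 1

/-- The generalized first-order Reed–Muller code `RM_q(1,m)`, the set of vectors
`u · G_m (mod q)` for `u ∈ (ℤ/qℤ)^{m+1}`. -/
def RM (q m : ℕ) : Set (Fin (2 ^ m) → ZMod q) :=
  {c | ∃ u : Fin (m + 1) → ZMod q, c = u ᵥ* ((G m).map (Int.cast : ℤ → ZMod q))}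

/-- `ξ = exp(2πj/q)`, a primitive `q`-th root of unity. -/
def xi (q : ℕ) : ℂ := Complex.exp (2 * Real.pi * Complex.I / q)

/-- The polyphase codewords of `RM_q(1,m)`: vectors `ξ^c` for `c ∈ RM_q(1,m)`. -/
def polyRM (q m : ℕ) : Set (Fin (2 ^ m) → ℂ) :=
  {x | ∃ c ∈ RM q m, x = fun k => xi q ^ (c k).val}

/-- Complex dot product `⟨y, x⟩ = Σ_k y_k conj(x_k)`. -/
def dotc {n : ℕ} (y x : Fin n → ℂ) : ℂ := ∑ k, y k * (starRingEnd ℂ) (x k)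

/-- Squared Euclidean distance `‖y - x‖²`. -/
def dist2 {n : ℕ} (y x : Fin n → ℂ) : ℝ := ∑ k, Complex.normSq (y k - x k)

/-- Concatenation `(a | b)` of two vectors of length `2^m`, as a vector of
length `2^(m+1)`. -/
def rmAppend {α : Type*} {m : ℕ} (a b : Fin (2 ^ m) → α) : Fin (2 ^ (m + 1)) → α :=
  fun k => Fin.append a b (Fin.cast (two_pow_succ' m) k)

/-- The index `k` viewed in the first half of `Fin (2^(m+1))`. -/
def loIdx (m : ℕ) (k : Fin (2 ^ m)) : Fin (2 ^ (m + 1)) :=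
  Fin.cast (two_pow_succ' m).symm (Fin.castAdd (2 ^ m) k)

/-- The index `k + 2^m` in the second half of `Fin (2^(m+1))`. -/
def hiIdx (m : ℕ) (k : Fin (2 ^ m)) : Fin (2 ^ (m + 1)) :=
  Fin.cast (two_pow_succ' m).symm (Fin.natAdd (2 ^ m) k)

theorem sum_halves {M : Type*} [AddCommMonoid M] (m : ℕ) (f : Fin (2 ^ (m + 1)) → M) :
    ∑ k, f k = ∑ k, f (loIdx m k) + ∑ k, f (hiIdx m k) := by
  rw [← Equiv.sum_comp (finCongr (two_pow_succ' m).symm) f, Fin.sum_univ_add]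
  rfl

theorem idx_cases (m : ℕ) (k : Fin (2 ^ (m + 1))) :
    (∃ j, k = loIdx m j) ∨ ∃ j, k = hiIdx m j := by
  have h2 := two_pow_succ' m
  have hk := k.2
  by_cases h : (k : ℕ) < 2 ^ m
  · exact Or.inl ⟨⟨k, h⟩, by ext; simp [loIdx]⟩
  · refine Or.inr ⟨⟨k - 2 ^ m, by omega⟩, ?_⟩
    ext
    simp [hiIdx]
    omega

theorem append_lo {α : Type*} (m : ℕ) (a b : Fin (2 ^ m) → α) (k : Fin (2 ^ m)) :
    rmAppend a b (loIdx m k) = a k := by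
  simp [rmAppend, loIdx]

theorem append_hi {α : Type*} (m : ℕ) (a b : Fin (2 ^ m) → α) (k : Fin (2 ^ m)) :
    rmAppend a b (hiIdx m k) = b k := by
  exact Fin.append_right a b k

theorem vecMul_lo (q n : ℕ) (u : Fin (n + 1 + 1 + 1) → ZMod q) (k : Fin (2 ^ (n + 1))) :
    (u ᵥ* ((G (n + 2)).map (Int.cast : ℤ → ZMod q))) (loIdx (n + 1) k) =
      ((fun i : Fin (n + 2) => u i.castSucc) ᵥ* ((G (n + 1)).map (Int.cast : ℤ → ZMod q))) k := by
  have hk : (k : ℕ) % 2 ^ (n + 1) = k := Nat.mod_eq_of_lt k.2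
  simp only [Matrix.vecMul, dotProduct]
  rw [Fin.sum_univ_castSucc]
  simp [G, loIdx, hk]

theorem vecMul_hi (q n : ℕ) (u : Fin (n + 1 + 1 + 1) → ZMod q) (k : Fin (2 ^ (n + 1))) :
    (u ᵥ* ((G (n + 2)).map (Int.cast : ℤ → ZMod q))) (hiIdx (n + 1) k) =
      ((fun i : Fin (n + 2) => u i.castSucc) ᵥ* ((G (n + 1)).map (Int.cast : ℤ → ZMod q))) k
        + u (Fin.last _) := by
  have hk : (k : ℕ) % 2 ^ (n + 1) = k := Nat.mod_eq_of_lt k.2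
  simp only [Matrix.vecMul, dotProduct]
  rw [Fin.sum_univ_castSucc]
  simp [G, hiIdx, hk]

theorem xi_pow_q (q : ℕ) (hq : 1 ≤ q) : xi q ^ q = 1 :=
  (Complex.isPrimitiveRoot_exp q (by omega)).pow_eq_one

theorem xi_val_add (q : ℕ) (hq : 1 ≤ q) (a b : ZMod q) :
    xi q ^ (a + b).val = xi q ^ b.val * xi q ^ a.val := by
  have : NeZero q := ⟨by omega⟩
  rw [ZMod.val_add, ← pow_eq_pow_mod _ (xi_pow_q q hq), pow_add, mul_comm]

theorem xi_norm (q : ℕ) (hq : 1 ≤ q) : ‖xi q‖ = 1 :=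
  Complex.norm_eq_one_of_pow_eq_one (xi_pow_q q hq) (by omega)

theorem conj_xi_pow (q : ℕ) (hq : 1 ≤ q) (i : ℕ) :
    (starRingEnd ℂ) (xi q ^ i) = xi q ^ (-(i : ℤ)) := by
  rw [_root_.zpow_neg, zpow_natCast, Complex.inv_eq_conj]
  simp [xi_norm q hq]

theorem poly_split (q m : ℕ) (hq : 1 ≤ q) (hm : 1 ≤ m) (x : Fin (2 ^ (m + 1)) → ℂ)
    (hx : x ∈ polyRM q (m + 1)) :
    ∃ w ∈ polyRM q m, ∃ i < q, x = rmAppend w (fun k => xi q ^ i * w k) := by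
  have : NeZero q := ⟨by omega⟩
  obtain ⟨n, rfl⟩ : ∃ n, m = n + 1 := ⟨m - 1, by omega⟩
  obtain ⟨c, ⟨u, rfl⟩, rfl⟩ := hx
  refine ⟨_, ⟨_, ⟨fun i => u i.castSucc, rfl⟩, rfl⟩, (u (Fin.last _)).val, ZMod.val_lt _, ?_⟩
  funext k
  rcases idx_cases _ k with ⟨j, rfl⟩ | ⟨j, rfl⟩
  · rw [append_lo, vecMul_lo]
  · rw [append_hi, vecMul_hi, xi_val_add q hq]

theorem poly_join (q m : ℕ) (hq : 1 ≤ q) (hm : 1 ≤ m) (w : Fin (2 ^ m) → ℂ)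
    (hw : w ∈ polyRM q m) (i : ℕ) (hi : i < q) :
    rmAppend w (fun k => xi q ^ i * w k) ∈ polyRM q (m + 1) := by
  obtain ⟨n, rfl⟩ : ∃ n, m = n + 1 := ⟨m - 1, by omega⟩
  obtain ⟨c, ⟨u, rfl⟩, rfl⟩ := hw
  refine ⟨_, ⟨Fin.snoc (α := fun _ => ZMod q) u (i : ZMod q), rfl⟩, ?_⟩
  funext k
  rcases idx_cases _ k with ⟨j, rfl⟩ | ⟨j, rfl⟩
  · rw [append_lo, vecMul_lo]
    simp only [Fin.snoc_castSucc]
  · rw [append_hi, vecMul_hi, xi_val_add q hq]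
    simp only [Fin.snoc_castSucc, Fin.snoc_last, ZMod.val_natCast, Nat.mod_eq_of_lt hi]

theorem dotc_join (q m : ℕ) (hq : 1 ≤ q) (y : Fin (2 ^ (m + 1)) → ℂ) (w : Fin (2 ^ m) → ℂ)
    (i : ℕ) (z : Fin (2 ^ m) → ℂ)
    (hz : ∀ k, z k = y (loIdx m k) + y (hiIdx m k) * xi q ^ (-(i : ℤ))) :
    dotc y (rmAppend w (fun k => xi q ^ i * w k)) = dotc z w := by
  unfold dotc
  rw [sum_halves, ← Finset.sum_add_distrib]
  refine Finset.sum_congr rfl fun k _ => ?_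
  rw [append_lo, append_hi, hz, map_mul, conj_xi_pow q hq]
  ring

theorem dist2_eq (q m : ℕ) (hq : 1 ≤ q) (y x : Fin (2 ^ m) → ℂ) (hx : x ∈ polyRM q m) :
    dist2 y x = ∑ k, (Complex.normSq (y k) + 1) - 2 * (dotc y x).re := by
  obtain ⟨c, -, rfl⟩ := hx
  unfold dist2 dotc
  rw [Complex.re_sum, Finset.mul_sum, ← Finset.sum_sub_distrib]
  refine Finset.sum_congr rfl fun k _ => ?_
  rw [Complex.normSq_sub]
  have : Complex.normSq (xi q ^ (c k).val) = 1 := by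
    rw [Complex.normSq_eq_norm_sq, norm_pow, xi_norm q hq]; simp
  rw [this]

/-- correctness of the recursive ML decoding step.  If for each
`i < q` the vector `ẑ(i)` is a polyphase codeword of `RM_q(1,m)` maximizing
`Re⟨z(i),w⟩`, `p(i) = Re⟨z(i),ẑ(i)⟩`, and `î < q` maximizes `p`, then
`x̂ = (ẑ(î) | ξ^î·ẑ(î))` is a polyphase codeword of `RM_q(1,m+1)` minimizing
`‖y − x‖²` over all polyphase codewords of `RM_q(1,m+1)`, and
`Re⟨y,x̂⟩ = p(î)`.  (The paper's `m ≥ 2` is written as `m + 1`, `m ≥ 1`.) -/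
theorem stmt9 (q m : ℕ) (hq : 1 ≤ q) (hm : 1 ≤ m) (y : Fin (2 ^ (m + 1)) → ℂ)
    (z : ℕ → Fin (2 ^ m) → ℂ)
    (hz : ∀ i k, z i k = y (loIdx m k) + y (hiIdx m k) * xi q ^ (-(i : ℤ)))
    (zhat : ℕ → Fin (2 ^ m) → ℂ)
    (hmem : ∀ i < q, zhat i ∈ polyRM q m)
    (hmax : ∀ i < q, ∀ w ∈ polyRM q m, (dotc (z i) w).re ≤ (dotc (z i) (zhat i)).re)
    (p : ℕ → ℝ) (hp : ∀ i, p i = (dotc (z i) (zhat i)).re)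
    (ihat : ℕ) (hihat : ihat < q) (hbest : ∀ i < q, p i ≤ p ihat)
    (xhat : Fin (2 ^ (m + 1)) → ℂ)
    (hxhat : xhat = rmAppend (zhat ihat) (fun k => xi q ^ ihat * zhat ihat k)) :
    xhat ∈ polyRM q (m + 1) ∧
      (∀ x ∈ polyRM q (m + 1), dist2 y xhat ≤ dist2 y x) ∧
      (dotc y xhat).re = p ihat := by
  have hxm : xhat ∈ polyRM q (m + 1) := by
    rw [hxhat]
    exact poly_join q m hq hm _ (hmem _ hihat) _ hihat
  have hdot : (dotc y xhat).re = p ihat := by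
    rw [hxhat, dotc_join q m hq y _ ihat (z ihat) (hz ihat), hp]
  refine ⟨hxm, fun x hx => ?_, hdot⟩
  rw [dist2_eq q _ hq y _ hxm, dist2_eq q _ hq y _ hx, hdot]
  obtain ⟨w, hw, i, hi, rfl⟩ := poly_split q m hq hm x hx
  rw [dotc_join q m hq y _ i (z i) (hz i)]
  have h1 := hmax i hi w hw
  have h2 := hbest i hi
  rw [hp i] at h2
  linarith
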